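/- Weighted gradient bound for the discrete heat kernel on ℤ: there exists a constant C > 0 such that for all c > 0 and all t ≥ 0, Σ_{k∈ℤ} |p̄_t(k+1) - p̄_t(k)|·|k| ≤ C. -/

import Mathlib

/-- `n`-step simple random walk distribution on `ℤ`:
`q_n(ℓ) = 2^{-n}·binom(n,(n+ℓ)/2)` if `n+ℓ` is even and `|ℓ| ≤ n`, and `0` otherwise. -/
noncomputable def rwStep (n : ℕ) (l : ℤ) : ℝ :=
  if ((n : ℤ) + l) % 2 = 0 ∧ |l| ≤ (n : ℤ) then
    ((1 : ℝ) / 2) ^ n * (Nat.choose n (((n : ℤ) + l) / 2).toNat : ℝ)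
  else 0

/-- The discrete heat kernel on `ℤ` sped up by `2c`:
`p̄_t(ℓ) = e^{-2ct} Σ_{n≥0} ((2ct)^n/n!) q_n(ℓ)`. -/
noncomputable def heatKernelZ (c t : ℝ) (l : ℤ) : ℝ :=
  Real.exp (-(2 * c * t)) * ∑' n : ℕ, (2 * c * t) ^ n / (Nat.factorial n : ℝ) * rwStep n l

theorem rwStep_of_add_eq {n k : ℕ} {l : ℤ} (h : (n : ℤ) + l = 2 * k) :
    rwStep n l = (1 / 2) ^ n * (n.choose k : ℝ) := by
  unfold rwStep
  have hk : (((n : ℤ) + l) / 2).toNat = k := by omega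
  rw [hk]
  split_ifs with hc
  · rfl
  · have : n < k := by
      by_contra hnk
      exact hc ⟨by omega, by rw [abs_le]; omega⟩
    simp [Nat.choose_eq_zero_of_lt this]

theorem rwStep_of_add_neg {n : ℕ} {l : ℤ} (h : (n : ℤ) + l < 0) : rwStep n l = 0 := by
  unfold rwStep
  rw [if_neg]
  rintro ⟨-, h2⟩
  rw [abs_le] at h2
  omega

theorem rwStep_of_odd {n : ℕ} {l : ℤ} (h : ((n : ℤ) + l) % 2 ≠ 0) : rwStep n l = 0 :=
  if_neg fun hc => h hc.1

theorem rwStep_nonneg (n : ℕ) (l : ℤ) : 0 ≤ rwStep n l := by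
  unfold rwStep
  split_ifs <;> positivity

theorem rwStep_zero (l : ℤ) : rwStep 0 l = if l = 0 then 1 else 0 := by
  split_ifs with h
  · simp [h, rwStep]
  · refine if_neg fun hc => h ?_
    simpa using hc.2

theorem rwStep_succ (n : ℕ) (l : ℤ) :
    rwStep (n + 1) l = (rwStep n (l - 1) + rwStep n (l + 1)) / 2 := by
  rcases lt_or_ge ((n : ℤ) + 1 + l) 0 with hneg | hpos
  · rw [rwStep_of_add_neg (by push_cast; omega), rwStep_of_add_neg (by omega),
      rwStep_of_add_neg (by omega)]
    simp
  by_cases hodd : ((n : ℤ) + 1 + l) % 2 = 0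
  · obtain ⟨k, hk⟩ : ∃ k : ℕ, (n : ℤ) + 1 + l = 2 * k :=
      ⟨(((n : ℤ) + 1 + l) / 2).toNat, by omega⟩
    rw [rwStep_of_add_eq (n := n + 1) (k := k) (by push_cast; omega),
      rwStep_of_add_eq (l := l + 1) (k := k) (by omega)]
    cases k with
    | zero =>
      rw [rwStep_of_add_neg (by push_cast at hk; omega)]
      simp [pow_succ]
      ring
    | succ k =>
      rw [rwStep_of_add_eq (l := l - 1) (k := k) (by push_cast at hk; omega),
        Nat.choose_succ_succ]
      push_cast
      ring
  · rw [rwStep_of_odd (by push_cast; omega), rwStep_of_odd (by omega), rwStep_of_odd (by omega)]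
    simp

theorem rwStep_neg (n : ℕ) (l : ℤ) : rwStep n (-l) = rwStep n l := by
  induction n generalizing l with
  | zero => simp [rwStep_zero]
  | succ n ih =>
    rw [rwStep_succ, rwStep_succ, ← ih (l - 1), ← ih (l + 1), add_comm]
    congr 3 <;> ring

theorem sum_rwStep_le_one (n : ℕ) (s : Finset ℤ) : ∑ l ∈ s, rwStep n l ≤ 1 := by
  induction n generalizing s with
  | zero =>
    simp only [rwStep_zero, Finset.sum_ite_eq']
    split_ifs <;> norm_num
  | succ n ih =>
    have h1 := ih (s.map (Equiv.subRight 1).toEmbedding)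
    have h2 := ih (s.map (Equiv.addRight 1).toEmbedding)
    simp only [Finset.sum_map, Equiv.coe_toEmbedding, Equiv.subRight_apply,
      Equiv.coe_addRight] at h1 h2
    simp only [rwStep_succ, ← Finset.sum_div, Finset.sum_add_distrib]
    linarith

theorem rwStep_le_one (n : ℕ) (l : ℤ) : rwStep n l ≤ 1 := by
  simpa using sum_rwStep_le_one n {l}

/-- The binomial transform of `n ↦ rwStep n l`: up to normalisation, the step distribution of the
random walk that stays put with probability `1 / 2`. -/
noncomputable def lazyStep (n : ℕ) (l : ℤ) : ℝ :=
  ∑ j ∈ Finset.range (n + 1), (n.choose j : ℝ) * rwStep j l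

theorem lazyStep_neg (n : ℕ) (l : ℤ) : lazyStep n (-l) = lazyStep n l := by
  simp [lazyStep, rwStep_neg]

theorem lazyStep_succ (n : ℕ) (l : ℤ) :
    lazyStep (n + 1) l = lazyStep n l + (lazyStep n (l - 1) + lazyStep n (l + 1)) / 2 := by
  have hshift : (lazyStep n (l - 1) + lazyStep n (l + 1)) / 2 =
      ∑ j ∈ Finset.range (n + 1), (n.choose j : ℝ) * rwStep (j + 1) l := by
    simp only [lazyStep, ← Finset.sum_add_distrib, Finset.sum_div, rwStep_succ]
    exact Finset.sum_congr rfl fun j _ => by ring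
  have hlast : lazyStep n l = ∑ j ∈ Finset.range (n + 2), (n.choose j : ℝ) * rwStep j l := by
    rw [Finset.sum_range_succ, lazyStep]
    simp
  rw [hshift, hlast, Finset.sum_range_succ', lazyStep, Finset.sum_range_succ']
  simp only [Nat.choose_succ_succ, Nat.cast_add, add_mul, Finset.sum_add_distrib,
    Nat.choose_zero_right]
  ring

theorem lazyStep_succ_le (n k : ℕ) : lazyStep n (k + 1) ≤ lazyStep n k := by
  induction n generalizing k with
  | zero =>
    have : (k : ℤ) + 1 ≠ 0 := by omega
    simpa [lazyStep, rwStep_zero, this] using by split_ifs <;> norm_num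
  | succ n ih =>
    rw [lazyStep_succ, lazyStep_succ]
    have h0 := ih k
    have h1 := ih (k + 1)
    push_cast at h1
    rw [add_sub_cancel_right]
    cases k with
    | zero =>
      have := lazyStep_neg n 1
      norm_num at *
      linarith
    | succ k =>
      have h2 := ih k
      push_cast at *
      rw [add_sub_cancel_right]
      linarith

theorem summable_pow_div_factorial_mul_rwStep {s : ℝ} (hs : 0 ≤ s) (l : ℤ) :
    Summable fun n : ℕ => s ^ n / (n.factorial : ℝ) * rwStep n l := by
  refine (Real.summable_pow_div_factorial s).of_nonneg_of_le
    (fun n => mul_nonneg (by positivity) (rwStep_nonneg n l))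
    fun n => mul_le_of_le_one_right (by positivity) (rwStep_le_one n l)

theorem Real.exp_eq_tsum_pow_div_factorial (s : ℝ) :
    Real.exp s = ∑' n : ℕ, s ^ n / (n.factorial : ℝ) := by
  rw [Real.exp_eq_exp_ℝ, NormedSpace.exp_eq_tsum_div]

theorem hasSum_lazyStep {s : ℝ} (hs : 0 ≤ s) (l : ℤ) :
    HasSum (fun n : ℕ => s ^ n / (n.factorial : ℝ) * lazyStep n l)
      (Real.exp s * ∑' n : ℕ, s ^ n / (n.factorial : ℝ) * rwStep n l) := by
  have hf := (summable_pow_div_factorial_mul_rwStep hs l).norm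
  have hg := (Real.summable_pow_div_factorial s).norm
  have hterm : ∀ n : ℕ, s ^ n / (n.factorial : ℝ) * lazyStep n l =
      ∑ j ∈ Finset.range (n + 1), s ^ j / (j.factorial : ℝ) * rwStep j l *
        (s ^ (n - j) / ((n - j).factorial : ℝ)) := by
    intro n
    rw [lazyStep, Finset.mul_sum]
    refine Finset.sum_congr rfl fun j hj => ?_
    have hjn : j ≤ n := Nat.lt_succ_iff.mp (Finset.mem_range.mp hj)
    have hn : (n.factorial : ℝ) ≠ 0 := by positivity
    rw [Nat.cast_choose ℝ hjn, ← pow_mul_pow_sub s hjn, ← mul_assoc, div_mul_div_cancel₀ hn,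
      mul_div_mul_comm]
    ring
  rw [mul_comm (Real.exp s), Real.exp_eq_tsum_pow_div_factorial s, funext hterm]
  exact hasSum_sum_range_mul_of_summable_norm (R := ℝ)
    (f := fun n : ℕ => s ^ n / (n.factorial : ℝ) * rwStep n l)
    (g := fun n : ℕ => s ^ n / (n.factorial : ℝ)) hf hg

theorem heatKernelZ_neg (c t : ℝ) (l : ℤ) : heatKernelZ c t (-l) = heatKernelZ c t l := by
  simp [heatKernelZ, rwStep_neg]

section

variable {c t : ℝ}

theorem heatKernelZ_nonneg (hs : 0 ≤ 2 * c * t) (l : ℤ) : 0 ≤ heatKernelZ c t l :=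
  mul_nonneg (Real.exp_nonneg _)
    (tsum_nonneg fun n => mul_nonneg (by positivity) (rwStep_nonneg n l))

theorem heatKernelZ_succ_le (hs : 0 ≤ 2 * c * t) (k : ℕ) :
    heatKernelZ c t (k + 1) ≤ heatKernelZ c t k := by
  have h := hasSum_le
    (fun n => mul_le_mul_of_nonneg_left (lazyStep_succ_le n k) (by positivity))
    (hasSum_lazyStep hs (k + 1)) (hasSum_lazyStep hs k)
  exact mul_le_mul_of_nonneg_left (le_of_mul_le_mul_left h (Real.exp_pos _)) (Real.exp_nonneg _)

theorem sum_heatKernelZ_le_one (hs : 0 ≤ 2 * c * t) (F : Finset ℤ) :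
    ∑ l ∈ F, heatKernelZ c t l ≤ 1 := by
  have hsum := fun l (_ : l ∈ F) => summable_pow_div_factorial_mul_rwStep hs l
  simp only [heatKernelZ]
  rw [← Finset.mul_sum, ← Summable.tsum_finsetSum hsum, Real.exp_neg,
    inv_mul_le_one₀ (Real.exp_pos _),
    Real.exp_eq_tsum_pow_div_factorial]
  refine Summable.tsum_le_tsum (fun n => ?_) (summable_sum hsum)
    (Real.summable_pow_div_factorial _)
  rw [← Finset.mul_sum]
  exact mul_le_of_le_one_right (by positivity) (sum_rwStep_le_one n F)

theorem sum_range_heatKernelZ_le_one (hs : 0 ≤ 2 * c * t) (K : ℕ) :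
    ∑ k ∈ Finset.range K, heatKernelZ c t k ≤ 1 := by
  simpa using sum_heatKernelZ_le_one hs ((Finset.range K).map Nat.castEmbedding)

end

theorem sum_range_sub_succ_mul_succ (f : ℕ → ℝ) (K : ℕ) :
    ∑ k ∈ Finset.range K, (f k - f (k + 1)) * (k + 1) =
      ∑ k ∈ Finset.range K, f k - K * f K := by
  induction K with
  | zero => simp
  | succ K ih =>
    rw [Finset.sum_range_succ, ih, Finset.sum_range_succ]
    push_cast
    ring

/-- Weighted gradient bound for the discrete heat kernel on `ℤ`:
there is a universal constant `C > 0` with `Σ_{k∈ℤ} |∇p̄_t(k)|·|k| ≤ C`. -/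
theorem heatKernelZ_grad_weighted :
    ∃ C : ℝ, 0 < C ∧ ∀ c t : ℝ, 0 < c → 0 ≤ t →
      Summable (fun k : ℤ => |heatKernelZ c t (k + 1) - heatKernelZ c t k| * |(k : ℝ)|) ∧
      ∑' k : ℤ, |heatKernelZ c t (k + 1) - heatKernelZ c t k| * |(k : ℝ)| ≤ C := by
  refine ⟨2, two_pos, fun c t hc ht => ?_⟩
  have hs : 0 ≤ 2 * c * t := by positivity
  set F : ℤ → ℝ := fun k => |heatKernelZ c t (k + 1) - heatKernelZ c t k| * |(k : ℝ)| with hF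
  have hF0 : ∀ k, 0 ≤ F k := fun k => by positivity
  have hneg : ∀ k : ℕ, F (-((k : ℤ) + 1)) =
      (heatKernelZ c t k - heatKernelZ c t (k + 1 : ℕ)) * (k + 1) := by
    intro k
    have h1 : -((k : ℤ) + 1) + 1 = -(k : ℤ) := by ring
    simp only [hF, h1, heatKernelZ_neg]
    rw [abs_of_nonneg (sub_nonneg.2 (heatKernelZ_succ_le hs k))]
    push_cast
    rw [abs_neg, abs_of_nonneg (by positivity)]
  have hpos : ∀ k : ℕ, F k ≤ F (-((k : ℤ) + 1)) := by
    intro k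
    rw [hneg]
    simp only [hF]
    have h := sub_nonneg.2 (heatKernelZ_succ_le hs k)
    rw [abs_sub_comm, abs_of_nonneg h]
    push_cast
    rw [abs_of_nonneg (by positivity)]
    exact mul_le_mul_of_nonneg_left (by linarith) h
  have hbound : ∀ K, ∑ k ∈ Finset.range K, F (-((k : ℤ) + 1)) ≤ 1 := by
    intro K
    simp only [hneg]
    rw [sum_range_sub_succ_mul_succ fun k : ℕ => heatKernelZ c t k]
    have h1 := sum_range_heatKernelZ_le_one hs K
    have h2 := mul_nonneg K.cast_nonneg (heatKernelZ_nonneg hs (K : ℤ))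
    linarith
  have hsneg : Summable fun k : ℕ => F (-((k : ℤ) + 1)) :=
    summable_of_sum_range_le (fun _ => hF0 _) hbound
  have hspos : Summable fun k : ℕ => F k := hsneg.of_nonneg_of_le (fun _ => hF0 _) hpos
  have hle : ∑' k : ℕ, F (-((k : ℤ) + 1)) ≤ 1 :=
    Real.tsum_le_of_sum_range_le (fun _ => hF0 _) hbound
  have hle' := hspos.tsum_le_tsum hpos hsneg
  refine ⟨hspos.of_nat_of_neg_add_one hsneg, ?_⟩
  rw [tsum_of_nat_of_neg_add_one hspos hsneg]
  linarith
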